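/- arXiv:2410.04328 — 5 statements merged into one kernel-verified Lean document; each statement's English description precedes it below -/
import Mathlib

section
/- Let n ≥ 1 and let P : Fin n → ℝ be a probability distribution with P j > 0 for all j. For every real u ≥ 0, the tilted distribution Q^u defined by Q^u_j = (P j)^{u/(1+u)} / ∑_k (P k)^{u/(1+u)} maximizes Shannon entropy at its own divergence level: for every probability distribution R : Fin n → ℝ with D(R ‖ P) ≤ D(Q^u ‖ P), one has H(R) ≤ H(Q^u). -/
open Finset

/-- Kullback–Leibler divergence `D(Q ‖ P) = ∑ j, Q j * log (Q j / P j)`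
(natural log; the convention `0 * log 0 = 0` holds automatically in `ℝ`). -/
noncomputable def KLdiv {n : ℕ} (Q P : Fin n → ℝ) : ℝ :=
  ∑ j, Q j * Real.log (Q j / P j)

/-- Shannon entropy `H(Q) = -∑ j, Q j * log (Q j)` (natural log). -/
noncomputable def shannonEntropy {n : ℕ} (Q : Fin n → ℝ) : ℝ :=
  -∑ j, Q j * Real.log (Q j)

/-- The tilted distribution `Q^u_j = (P j)^{u/(1+u)} / ∑ k, (P k)^{u/(1+u)}`. -/
noncomputable def tilted {n : ℕ} (P : Fin n → ℝ) (u : ℝ) (j : Fin n) : ℝ :=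
  (P j) ^ (u / (1 + u)) / ∑ k, (P k) ^ (u / (1 + u))

/-- Gibbs' inequality: entropy is at most cross-entropy against a positive distribution. -/
theorem shannonEntropy_le_crossEntropy {n : ℕ} {R Q : Fin n → ℝ} (hR : ∀ j, 0 ≤ R j)
    (hQ : ∀ j, 0 < Q j) (hsum : ∑ j, Q j = ∑ j, R j) :
    shannonEntropy R ≤ -∑ j, R j * Real.log (Q j) := by
  have key : ∀ j, R j * Real.log (Q j) - R j * Real.log (R j) ≤ Q j - R j := by
    intro j
    rcases (hR j).eq_or_lt with h | h
    · simpa [← h] using (hQ j).le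
    · have h1 := Real.log_le_sub_one_of_pos (div_pos (hQ j) h)
      rw [Real.log_div (hQ j).ne' h.ne'] at h1
      have h2 := mul_le_mul_of_nonneg_left h1 h.le
      have h3 : R j * (Q j / R j - 1) = Q j - R j := by field_simp
      linarith
  have h := Finset.sum_le_sum fun j (_ : j ∈ Finset.univ) => key j
  simp only [Finset.sum_sub_distrib] at h
  unfold shannonEntropy
  linarith

/-- The divergence is cross-entropy minus entropy. -/
theorem KLdiv_eq_neg_shannonEntropy_sub {n : ℕ} (R : Fin n → ℝ) {P : Fin n → ℝ}
    (hP : ∀ j, 0 < P j) :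
    KLdiv R P = -shannonEntropy R - ∑ j, R j * Real.log (P j) := by
  rw [KLdiv, shannonEntropy, neg_neg, ← Finset.sum_sub_distrib]
  refine Finset.sum_congr rfl fun j _ => ?_
  rcases eq_or_ne (R j) 0 with h | h
  · simp [h]
  · rw [Real.log_div h (hP j).ne', mul_sub]

theorem stmt2 (n : ℕ) (hn : 1 ≤ n) (P : Fin n → ℝ)
    (hPpos : ∀ j, 0 < P j) (hPsum : ∑ j, P j = 1)
    (u : ℝ) (hu : 0 ≤ u) :
    ∀ R : Fin n → ℝ, (∀ j, 0 ≤ R j) → (∑ j, R j = 1) →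
      KLdiv R P ≤ KLdiv (tilted P u) P →
        shannonEntropy R ≤ shannonEntropy (tilted P u) := by
  intro R hR hRsum hD
  set s : ℝ := u / (1 + u) with hs
  set Z : ℝ := ∑ k, P k ^ s with hZ
  have hs0 : 0 ≤ s := by positivity
  have hs1 : s < 1 := by rw [hs, div_lt_one (by linarith)]; linarith
  have hZpos : 0 < Z :=
    Finset.sum_pos (fun k _ => Real.rpow_pos_of_pos (hPpos k) s) ⟨⟨0, hn⟩, Finset.mem_univ _⟩
  have hQpos : ∀ j, 0 < tilted P u j := fun j =>
    div_pos (Real.rpow_pos_of_pos (hPpos j) s) hZpos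
  have hQsum : ∑ j, tilted P u j = 1 := by
    simp only [tilted]
    rw [← Finset.sum_div]
    exact div_self hZpos.ne'
  have hlog : ∀ j, Real.log (tilted P u j) = s * Real.log (P j) - Real.log Z := fun j => by
    rw [← Real.log_rpow (hPpos j),
      ← Real.log_div (Real.rpow_pos_of_pos (hPpos j) s).ne' hZpos.ne']
    rfl
  have hcross : ∀ T : Fin n → ℝ, ∑ j, T j = 1 →
      ∑ j, T j * Real.log (tilted P u j) = s * (∑ j, T j * Real.log (P j)) - Real.log Z := by
    intro T hT
    rw [Finset.mul_sum, ← one_mul (Real.log Z), ← hT, Finset.sum_mul, ← Finset.sum_sub_distrib]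
    exact Finset.sum_congr rfl fun j _ => by rw [hlog]; ring
  have hGibbs := shannonEntropy_le_crossEntropy hR hQpos (hQsum.trans hRsum.symm)
  have hQ : shannonEntropy (tilted P u) = -∑ j, tilted P u j * Real.log (tilted P u j) := rfl
  rw [hcross R hRsum] at hGibbs
  rw [hcross _ hQsum] at hQ
  rw [KLdiv_eq_neg_shannonEntropy_sub R hPpos, KLdiv_eq_neg_shannonEntropy_sub _ hPpos] at hD
  have hmul := mul_le_mul_of_nonneg_left hD hs0
  refine le_of_mul_le_mul_left ?_ (sub_pos.mpr hs1)
  linarith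
end

section
/- Let n ≥ 1 and let P : Fin n → ℝ be a probability distribution with P j > 0 for all j. The function g : ℝ → ℝ given by g(u) = D(Q^u ‖ P), where Q^u is the tilted distribution Q^u_j = (P j)^{u/(1+u)} / ∑_k (P k)^{u/(1+u)}, is monotonically non-increasing on the interval [0, ∞): for all 0 ≤ u ≤ v, g(v) ≤ g(u). -/
open Finset

/-- Gibbs' inequality for positive distributions. -/
theorem KLdiv_nonneg {n : ℕ} {Q R : Fin n → ℝ} (hQ : ∀ j, 0 < Q j) (hR : ∀ j, 0 < R j)
    (hsum : ∑ j, Q j = ∑ j, R j) : 0 ≤ KLdiv Q R := by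
  have h : ∑ j, (Q j - R j) ≤ KLdiv Q R := by
    refine Finset.sum_le_sum fun j _ => ?_
    have h1 := Real.one_sub_inv_le_log_of_pos (div_pos (hQ j) (hR j))
    calc Q j - R j = Q j * (1 - (Q j / R j)⁻¹) := by
          have := (hQ j).ne'
          field_simp
      _ ≤ Q j * Real.log (Q j / R j) := mul_le_mul_of_nonneg_left h1 (hQ j).le
  rwa [Finset.sum_sub_distrib, hsum, sub_self] at h

theorem KLdiv_eq_sub {n : ℕ} {Q R : Fin n → ℝ} (hQ : ∀ j, 0 < Q j) (hR : ∀ j, 0 < R j) :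
    KLdiv Q R = ∑ j, Q j * Real.log (Q j) - ∑ j, Q j * Real.log (R j) := by
  rw [← Finset.sum_sub_distrib]
  refine Finset.sum_congr rfl fun j _ => ?_
  rw [Real.log_div (hQ j).ne' (hR j).ne', mul_sub]

section Tilted

variable {n : ℕ} {P : Fin n → ℝ}

theorem sum_rpow_pos [NeZero n] (hP : ∀ j, 0 < P j) (s : ℝ) : 0 < ∑ k, P k ^ s :=
  Finset.sum_pos (fun k _ => Real.rpow_pos_of_pos (hP k) s) Finset.univ_nonempty

theorem tilted_pos [NeZero n] (hP : ∀ j, 0 < P j) (u : ℝ) (j : Fin n) : 0 < tilted P u j :=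
  div_pos (Real.rpow_pos_of_pos (hP j) _) (sum_rpow_pos hP _)

theorem sum_tilted [NeZero n] (hP : ∀ j, 0 < P j) (u : ℝ) : ∑ j, tilted P u j = 1 := by
  simp only [tilted]
  rw [← Finset.sum_div, div_self (sum_rpow_pos hP _).ne']

theorem log_tilted [NeZero n] (hP : ∀ j, 0 < P j) (u : ℝ) (j : Fin n) :
    Real.log (tilted P u j) =
      u / (1 + u) * Real.log (P j) - Real.log (∑ k, P k ^ (u / (1 + u))) := by
  rw [tilted, Real.log_div (Real.rpow_pos_of_pos (hP j) _).ne' (sum_rpow_pos hP _).ne',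
    Real.log_rpow (hP j)]

theorem sum_mul_log_tilted [NeZero n] (hP : ∀ j, 0 < P j) (u : ℝ) {Q : Fin n → ℝ}
    (hQ : ∑ j, Q j = 1) :
    ∑ j, Q j * Real.log (tilted P u j) =
      u / (1 + u) * ∑ j, Q j * Real.log (P j) - Real.log (∑ k, P k ^ (u / (1 + u))) := by
  simp only [log_tilted hP, mul_sub, Finset.sum_sub_distrib, ← Finset.sum_mul, hQ, one_mul,
    mul_left_comm _ (u / (1 + u)), ← Finset.mul_sum]

end Tilted

theorem stmt4 (n : ℕ) (hn : 1 ≤ n) (P : Fin n → ℝ)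
    (hPpos : ∀ j, 0 < P j) (hPsum : ∑ j, P j = 1)
    (u v : ℝ) (hu : 0 ≤ u) (huv : u ≤ v) :
    KLdiv (tilted P v) P ≤ KLdiv (tilted P u) P := by
  rcases huv.eq_or_lt with rfl | huv
  · exact le_rfl
  have : NeZero n := ⟨by lia⟩
  have hst : u / (1 + u) < v / (1 + v) := by
    rw [div_lt_div_iff₀ (by linarith) (by linarith)]
    linarith
  have ht : v / (1 + v) < 1 := by
    rw [div_lt_one (by linarith)]
    linarith
  have hA := tilted_pos hPpos u
  have hB := tilted_pos hPpos v
  have sA := sum_tilted hPpos u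
  have sB := sum_tilted hPpos v
  have hAB := KLdiv_nonneg hA hB (sA.trans sB.symm)
  have hBA := KLdiv_nonneg hB hA (sB.trans sA.symm)
  rw [KLdiv_eq_sub hA hB, sum_mul_log_tilted hPpos u sA, sum_mul_log_tilted hPpos v sA] at hAB
  rw [KLdiv_eq_sub hB hA, sum_mul_log_tilted hPpos u sB, sum_mul_log_tilted hPpos v sB] at hBA
  rw [KLdiv_eq_sub hA hPpos, KLdiv_eq_sub hB hPpos, sum_mul_log_tilted hPpos u sA,
    sum_mul_log_tilted hPpos v sB]
  have hmean : ∑ j, tilted P u j * Real.log (P j) ≤ ∑ j, tilted P v j * Real.log (P j) := by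
    refine le_of_mul_le_mul_left ?_ (sub_pos.mpr hst)
    linarith
  linarith [mul_nonneg (sub_nonneg.mpr ht.le) (sub_nonneg.mpr hmean)]
end

section
/- Let n ≥ 1 and let P : Fin n → ℝ be a probability distribution with P j > 0 for all j. The divergence of the tilted distribution from P tends to zero as the tilting parameter tends to infinity: the function u ↦ D(Q^u ‖ P), where Q^u_j = (P j)^{u/(1+u)} / ∑_k (P k)^{u/(1+u)}, tends to 0 as u → ∞. -/
open Finset

theorem tendsto_div_one_add_atTop :
    Filter.Tendsto (fun u : ℝ => u / (1 + u)) Filter.atTop (nhds 1) := by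
  have h : Filter.Tendsto (fun u : ℝ => 1 - (1 + u)⁻¹) Filter.atTop (nhds 1) := by
    simpa using (Filter.tendsto_atTop_add_const_left _ (1 : ℝ)
      Filter.tendsto_id).inv_tendsto_atTop.const_sub 1
  refine h.congr' ?_
  filter_upwards [Filter.eventually_ge_atTop 0] with u hu
  field_simp
  ring

theorem tendsto_tilted {n : ℕ} {P : Fin n → ℝ} (hPpos : ∀ j, 0 < P j)
    (hPsum : ∑ j, P j = 1) (j : Fin n) :
    Filter.Tendsto (fun u : ℝ => tilted P u j) Filter.atTop (nhds (P j)) := by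
  have h (k : Fin n) :
      Filter.Tendsto (fun u : ℝ => P k ^ (u / (1 + u))) Filter.atTop (nhds (P k)) := by
    simpa using tendsto_const_nhds.rpow tendsto_div_one_add_atTop (Or.inl (hPpos k).ne')
  simpa [tilted, hPsum, Pi.div_def] using
    (h j).div (tendsto_finsetSum univ fun k _ => h k) (by simp [hPsum])

theorem stmt6 (n : ℕ) (hn : 1 ≤ n) (P : Fin n → ℝ)
    (hPpos : ∀ j, 0 < P j) (hPsum : ∑ j, P j = 1) :
    Filter.Tendsto (fun u : ℝ => KLdiv (tilted P u) P)
      Filter.atTop (nhds 0) := by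
  have hterm (j : Fin n) : Filter.Tendsto
      (fun u : ℝ => tilted P u j * Real.log (tilted P u j / P j)) Filter.atTop (nhds 0) := by
    have h := tendsto_tilted hPpos hPsum j
    have hne : P j ≠ 0 := (hPpos j).ne'
    simpa [hne] using h.mul ((h.div_const (P j)).log (by simp [hne]))
  simpa [KLdiv] using tendsto_finsetSum univ fun j _ => hterm j
end

section
/- Let n ≥ 1 and let P : Fin n → ℝ be a probability distribution with P j > 0 for all j. The function g : ℝ → ℝ given by g(u) = D(Q^u ‖ P), where Q^u_j = (P j)^{u/(1+u)} / ∑_k (P k)^{u/(1+u)}, is differentiable at every u > 0, and its derivative satisfies deriv g u ≤ 0 for every u > 0. -/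
open Finset

lemma hasDerivAt_sum_mul_rpow {ι : Type*} [Fintype ι] (P w : ι → ℝ) (hP : ∀ j, 0 < P j) (s : ℝ) :
    HasDerivAt (fun s : ℝ => ∑ j, w j * P j ^ s) (∑ j, w j * Real.log (P j) * P j ^ s) s := by
  refine HasDerivAt.fun_sum fun j _ => ?_
  have h := ((hasDerivAt_id s).const_rpow (hP j)).const_mul (w j)
  refine h.congr_deriv ?_
  simp only [id]
  ring

lemma sum_mul_sq_le_sum_mul_sum_mul_sq {ι : Type*} [Fintype ι] (l q : ι → ℝ)
    (hq : ∀ j, 0 ≤ q j) :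
    (∑ j, l j * q j) ^ 2 ≤ (∑ j, q j) * ∑ j, l j * l j * q j := by
  refine Finset.sum_sq_le_sum_mul_sum_of_sq_le_mul _ (fun j _ => hq j)
    (fun j _ => mul_nonneg (mul_self_nonneg _) (hq j)) fun j _ => ?_
  exact le_of_eq (by ring)

lemma KLdiv_tilted {n : ℕ} (hn : 1 ≤ n) (P : Fin n → ℝ) (hP : ∀ j, 0 < P j) (u : ℝ) :
    KLdiv (tilted P u) P =
      (u / (1 + u) - 1) *
          ((∑ j, Real.log (P j) * P j ^ (u / (1 + u))) / ∑ j, P j ^ (u / (1 + u))) -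
        Real.log (∑ j, P j ^ (u / (1 + u))) := by
  have : NeZero n := ⟨by omega⟩
  unfold KLdiv tilted
  set s := u / (1 + u)
  have hZ : 0 < ∑ j, P j ^ s :=
    Finset.sum_pos (fun j _ => Real.rpow_pos_of_pos (hP j) s) Finset.univ_nonempty
  set Z := ∑ j, P j ^ s with hZdef
  have hterm : ∀ j, P j ^ s / Z * Real.log (P j ^ s / Z / P j) =
      (s - 1) / Z * (Real.log (P j) * P j ^ s) - Real.log Z / Z * P j ^ s := fun j => by
    have hs := Real.rpow_pos_of_pos (hP j) s
    rw [Real.log_div (div_pos hs hZ).ne' (hP j).ne', Real.log_div hs.ne' hZ.ne',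
      Real.log_rpow (hP j)]
    ring
  rw [Finset.sum_congr rfl fun j _ => hterm j, Finset.sum_sub_distrib, ← Finset.mul_sum,
    ← Finset.mul_sum, ← hZdef]
  field_simp

theorem stmt12 (n : ℕ) (hn : 1 ≤ n) (P : Fin n → ℝ)
    (hPpos : ∀ j, 0 < P j) (hPsum : ∑ j, P j = 1) :
    ∀ u : ℝ, 0 < u →
      DifferentiableAt ℝ (fun u : ℝ => KLdiv (tilted P u) P) u ∧
        deriv (fun u : ℝ => KLdiv (tilted P u) P) u ≤ 0 := by
  intro u hu
  have : NeZero n := ⟨by omega⟩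
  have hu1 : 0 < 1 + u := by linarith
  have hs : HasDerivAt (fun u : ℝ => u / (1 + u)) (1 / (1 + u) ^ 2) u := by
    have h := (hasDerivAt_id u).div ((hasDerivAt_id u).const_add 1) hu1.ne'
    refine h.congr_deriv ?_
    simp only [id]
    ring
  have hs1 : u / (1 + u) - 1 ≤ 0 := by
    rw [sub_nonpos, div_le_one hu1]
    linarith
  simp only [KLdiv_tilted hn P hPpos]
  have hZ := hasDerivAt_sum_mul_rpow P (fun _ => 1) hPpos (u / (1 + u))
  have hM := hasDerivAt_sum_mul_rpow P (fun j => Real.log (P j)) hPpos (u / (1 + u))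
  simp only [one_mul] at hZ
  have hZpos : 0 < ∑ j, P j ^ (u / (1 + u)) :=
    Finset.sum_pos (fun j _ => Real.rpow_pos_of_pos (hPpos j) _) Finset.univ_nonempty
  have hvar := sum_mul_sq_le_sum_mul_sum_mul_sq (fun j => Real.log (P j))
    (fun j => P j ^ (u / (1 + u))) fun j => (Real.rpow_pos_of_pos (hPpos j) _).le
  have hF := (((hasDerivAt_id (u / (1 + u))).sub_const 1).mul (hM.div hZ hZpos.ne')).sub
    (hZ.log hZpos.ne')
  have hG := HasDerivAt.comp u hF hs
  refine ⟨hG.differentiableAt, hG.deriv.trans_le ?_⟩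
  refine mul_nonpos_of_nonpos_of_nonneg ?_ (by positivity)
  simp only [id, one_mul, Pi.div_apply, add_sub_cancel_left]
  refine mul_nonpos_of_nonpos_of_nonneg hs1 (div_nonneg ?_ (sq_nonneg _))
  linarith
end

section
/- Let n ≥ 1 and let P : Fin n → ℝ be a probability distribution with P j > 0 for all j. For every real u ≥ 0, the Shannon entropy of the tilted distribution is at least that of the original distribution: H(Q^u) ≥ H(P), where Q^u_j = (P j)^{u/(1+u)} / ∑_k (P k)^{u/(1+u)}. -/
open Finset

/-- Gibbs' inequality. -/
theorem sum_mul_log_le_sum_mul_log {ι : Type*} [Fintype ι] {p q : ι → ℝ}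
    (hp : ∀ j, 0 < p j) (hq : ∀ j, 0 < q j) (hpq : ∑ j, q j ≤ ∑ j, p j) :
    ∑ j, p j * Real.log (q j) ≤ ∑ j, p j * Real.log (p j) := by
  have key : ∀ j, p j * Real.log (q j) - p j * Real.log (p j) ≤ q j - p j := fun j => by
    have h := Real.log_le_sub_one_of_pos (div_pos (hq j) (hp j))
    rw [Real.log_div (hq j).ne' (hp j).ne'] at h
    calc p j * Real.log (q j) - p j * Real.log (p j)
        = p j * (Real.log (q j) - Real.log (p j)) := by ring
      _ ≤ p j * (q j / p j - 1) := mul_le_mul_of_nonneg_left h (hp j).le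
      _ = q j - p j := by rw [mul_sub, mul_div_cancel₀ _ (hp j).ne', mul_one]
  have h := Finset.sum_le_sum fun j (_ : j ∈ Finset.univ) => key j
  simp only [Finset.sum_sub_distrib] at h
  linarith

theorem stmt13 (n : ℕ) (hn : 1 ≤ n) (P : Fin n → ℝ)
    (hPpos : ∀ j, 0 < P j) (hPsum : ∑ j, P j = 1)
    (u : ℝ) (hu : 0 ≤ u) :
    shannonEntropy P ≤ shannonEntropy (tilted P u) := by
  set t := u / (1 + u) with ht
  have ht0 : 0 ≤ t := by positivity
  have ht1 : 0 < 1 - t := by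
    have : 1 - t = 1 / (1 + u) := by rw [ht]; field_simp; ring
    rw [this]; positivity
  set Z := ∑ k, P k ^ t with hZ
  have hpow : ∀ j, 0 < P j ^ t := fun j => Real.rpow_pos_of_pos (hPpos j) t
  have hZpos : 0 < Z := Finset.sum_pos (fun j _ => hpow j) ⟨⟨0, hn⟩, Finset.mem_univ _⟩
  set Q := tilted P u with hQ
  have hQpos : ∀ j, 0 < Q j := fun j => div_pos (hpow j) hZpos
  have hQsum : ∑ j, Q j = 1 := by
    change ∑ j, P j ^ t / Z = 1
    rw [← Finset.sum_div, div_self hZpos.ne']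
  have hlog : ∀ j, Real.log (Q j) = t * Real.log (P j) - Real.log Z := fun j => by
    change Real.log (P j ^ t / Z) = _
    rw [Real.log_div (hpow j).ne' hZpos.ne', Real.log_rpow (hPpos j)]
  have expand : ∀ R : Fin n → ℝ, ∑ j, R j = 1 →
      ∑ j, R j * Real.log (Q j) = t * ∑ j, R j * Real.log (P j) - Real.log Z := by
    intro R hR
    simp only [hlog, mul_sub, Finset.sum_sub_distrib, ← Finset.sum_mul, hR, one_mul,
      Finset.mul_sum, mul_left_comm]
  have hPQ := sum_mul_log_le_sum_mul_log hPpos hQpos (by rw [hPsum, hQsum])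
  have hQP := sum_mul_log_le_sum_mul_log hQpos hPpos (by rw [hPsum, hQsum])
  unfold shannonEntropy
  rw [expand P hPsum] at hPQ
  rw [expand Q hQsum] at hQP ⊢
  have hmean : ∑ j, Q j * Real.log (P j) ≤ ∑ j, P j * Real.log (P j) :=
    le_of_mul_le_mul_left (by linarith) ht1
  linarith [mul_le_mul_of_nonneg_left hmean ht0]
end
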